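/- Let k ≥ 0, T > 0, and let u : [0,T] × ℝ → ℝ be smooth such that t ↦ u(t,·) is a C¹ map into Schwartz space and u solves the Camassa–Holm equation in nonlocal form: ∂_t u + u ∂_x u + ∂_x P = 0 with P(t,·) = K * (u(t,·)² + (1/2)(∂_x u(t,·))² + 2k u(t,·)) and K(x) = (1/2) e^{−|x|}. Then the functional H₁(u(t,·)) = (1/2)∫_ℝ (u(t,x)² + (∂_x u(t,x))²) dx is constant in t on [0,T]. -/

import Mathlib

open MeasureTheory SchwartzMap

/-- Convolution with the kernel `K(x) = (1/2) e^{−|x|}`. -/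
noncomputable def KConv (f : ℝ → ℝ) : ℝ → ℝ :=
  fun x => ∫ y : ℝ, (1 / 2) * Real.exp (-|x - y|) * f y

/-- The Camassa–Holm Hamiltonian `H₁(u) = (1/2) ∫ (u² + (u')²)`. -/
noncomputable def H1CH (u : ℝ → ℝ) : ℝ := (1 / 2) * ∫ x : ℝ, ((u x) ^ 2 + (deriv u x) ^ 2)

open Set Filter Topology in
/-- The left half of the convolution with `e^{−|x|}` solves `A' = f − A`. -/
theorem hasDerivAt_leftConv {f : ℝ → ℝ} (hc : Continuous f) (hf : Integrable f) (x : ℝ) :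
    HasDerivAt (fun x => Real.exp (-x) * ∫ y in Iic x, Real.exp y * f y)
      (f x - Real.exp (-x) * ∫ y in Iic x, Real.exp y * f y) x := by
  have hint : ∀ a : ℝ, IntegrableOn (fun y => Real.exp y * f y) (Iic a) := fun a =>
    hf.integrableOn.bdd_mul (c := Real.exp a) (by fun_prop)
      ((ae_restrict_mem measurableSet_Iic).mono fun y hy => by
        simpa [abs_of_pos (Real.exp_pos y)] using hy)
  have hcy : Continuous fun y => Real.exp y * f y := by fun_prop
  have h1 : HasDerivAt (fun x => ∫ y in Iic x, Real.exp y * f y) (Real.exp x * f x) x := by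
    have := (hcy.integral_hasStrictDerivAt 0 x).hasDerivAt.const_add
      (∫ y in Iic (0 : ℝ), Real.exp y * f y)
    refine this.congr_of_eventuallyEq (.of_forall fun z => ?_)
    simp [← intervalIntegral.integral_Iic_sub_Iic (hint 0) (hint z)]
  refine ((hasDerivAt_neg x).exp.mul h1).congr_deriv ?_
  have : Real.exp (-x) * Real.exp x = 1 := by rw [← Real.exp_add]; simp
  linear_combination f x * this

open Set Filter Topology in
/-- The right half of the convolution with `e^{−|x|}` solves `B' = B − f`. -/
theorem hasDerivAt_rightConv {f : ℝ → ℝ} (hc : Continuous f) (hf : Integrable f) (x : ℝ) :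
    HasDerivAt (fun x => Real.exp x * ∫ y in Ioi x, Real.exp (-y) * f y)
      ((Real.exp x * ∫ y in Ioi x, Real.exp (-y) * f y) - f x) x := by
  have h := (hasDerivAt_leftConv (f := fun y => f (-y)) (by fun_prop) hf.comp_neg (-x)).comp x
    (hasDerivAt_neg x)
  have key : ∀ z : ℝ, ∫ y in Iic (-z), Real.exp y * f (-y) = ∫ y in Ioi z, Real.exp (-y) * f y := by
    intro z
    have := integral_comp_neg_Iic (-z) (fun y => Real.exp (-y) * f y)
    simpa using this
  refine (h.congr_of_eventuallyEq (.of_forall fun z => ?_)).congr_deriv ?_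
  · simp [key]
  · simp [key]

open Set in
theorem KConv_eq_leftConv_add_rightConv {f : ℝ → ℝ} (hf : Integrable f) (x : ℝ) :
    KConv f x = 1 / 2 * ((Real.exp (-x) * ∫ y in Iic x, Real.exp y * f y)
      + Real.exp x * ∫ y in Ioi x, Real.exp (-y) * f y) := by
  have hint : Integrable fun y => (1 / 2) * Real.exp (-|x - y|) * f y :=
    hf.bdd_mul (c := 1 / 2) (by fun_prop) (.of_forall fun y => by
      simp [abs_of_pos (Real.exp_pos _)])
  rw [KConv, ← intervalIntegral.integral_Iic_add_Ioi (b := x) hint.integrableOn hint.integrableOn,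
    mul_add, ← integral_const_mul, ← integral_const_mul, ← integral_const_mul,
    ← integral_const_mul]
  congr 1
  · refine setIntegral_congr_fun measurableSet_Iic fun y hy => ?_
    have hy : y ≤ x := hy
    simp only [abs_of_nonneg (sub_nonneg.2 hy), neg_sub]
    rw [sub_eq_neg_add, Real.exp_add]
    ring
  · refine setIntegral_congr_fun measurableSet_Ioi fun y hy => ?_
    have hy : x < y := hy
    simp only [abs_of_neg (sub_neg.2 hy), neg_neg]
    rw [sub_eq_add_neg, Real.exp_add]
    ring

open Set in
theorem abs_leftConv_le {f : ℝ → ℝ} (hf : Integrable f) (x : ℝ) :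
    |Real.exp (-x) * ∫ y in Iic x, Real.exp y * f y| ≤ ∫ y in Iic x, |f y| := by
  rw [← integral_const_mul, ← Real.norm_eq_abs]
  refine norm_integral_le_of_norm_le hf.abs.integrableOn
    ((ae_restrict_mem measurableSet_Iic).mono fun y hy => ?_)
  have hy : y ≤ x := hy
  rw [← mul_assoc, ← Real.exp_add, norm_mul, Real.norm_eq_abs, Real.norm_eq_abs, Real.abs_exp]
  exact mul_le_of_le_one_left (abs_nonneg _) (Real.exp_le_one_iff.2 (by linarith))

open Set in
theorem abs_rightConv_le {f : ℝ → ℝ} (hf : Integrable f) (x : ℝ) :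
    |Real.exp x * ∫ y in Ioi x, Real.exp (-y) * f y| ≤ ∫ y in Ioi x, |f y| := by
  rw [← integral_const_mul, ← Real.norm_eq_abs]
  refine norm_integral_le_of_norm_le hf.abs.integrableOn
    ((ae_restrict_mem measurableSet_Ioi).mono fun y hy => ?_)
  have hy : x < y := hy
  rw [← mul_assoc, ← Real.exp_add, norm_mul, Real.norm_eq_abs, Real.norm_eq_abs, Real.abs_exp]
  exact mul_le_of_le_one_left (abs_nonneg _) (Real.exp_le_one_iff.2 (by linarith))

open Set in
/-- `P = K * f` solves `P − P'' = f`, and `P`, `P'` are bounded by the `L¹` norm of `f`. -/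
theorem KConv_hasDerivAt_and_bounds {f : ℝ → ℝ} (hc : Continuous f) (hf : Integrable f) (x : ℝ) :
    HasDerivAt (KConv f) (deriv (KConv f) x) x ∧
      HasDerivAt (deriv (KConv f)) (KConv f x - f x) x ∧
      |KConv f x| ≤ ∫ y, |f y| ∧ |deriv (KConv f) x| ≤ ∫ y, |f y| := by
  set A : ℝ → ℝ := fun x => Real.exp (-x) * ∫ y in Iic x, Real.exp y * f y with hA
  set B : ℝ → ℝ := fun x => Real.exp x * ∫ y in Ioi x, Real.exp (-y) * f y with hB
  have hP : KConv f = fun x => 1 / 2 * (A x + B x) :=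
    funext (KConv_eq_leftConv_add_rightConv hf)
  have dA : ∀ x, HasDerivAt A (f x - A x) x := hasDerivAt_leftConv hc hf
  have dB : ∀ x, HasDerivAt B (B x - f x) x := hasDerivAt_rightConv hc hf
  have dP : ∀ x, HasDerivAt (KConv f) (1 / 2 * (B x - A x)) x := fun x => by
    rw [hP]
    exact (((dA x).add (dB x)).const_mul (1 / 2)).congr_deriv (by ring)
  have hdP : deriv (KConv f) = fun x => 1 / 2 * (B x - A x) := funext fun x => (dP x).deriv
  have hsum : |A x| + |B x| ≤ ∫ y, |f y| := by
    rw [← intervalIntegral.integral_Iic_add_Ioi (b := x) hf.abs.integrableOn hf.abs.integrableOn]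
    exact add_le_add (abs_leftConv_le hf x) (abs_rightConv_le hf x)
  have h1 := abs_add_le (A x) (B x)
  have h2 := abs_sub (B x) (A x)
  have h3 := abs_nonneg (A x)
  have h4 := abs_nonneg (B x)
  refine ⟨(dP x).differentiableAt.hasDerivAt, ?_, ?_, ?_⟩
  · rw [hdP, hP]
    exact (((dB x).sub (dA x)).const_mul (1 / 2)).congr_deriv (by ring)
  · rw [hP]
    simp only [abs_mul, abs_of_pos (one_half_pos (α := ℝ))]
    linarith
  · rw [hdP]
    simp only [abs_mul, abs_of_pos (one_half_pos (α := ℝ))]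
    linarith

/-- A continuous curve of Schwartz functions decays quadratically, uniformly on compact times. -/
theorem SchwartzMap.exists_uniform_decay {v : ℝ → 𝓢(ℝ, ℝ)} (hv : Continuous v) (T : ℝ) :
    ∃ C, ∀ t ∈ Set.Icc 0 T, ∀ x, |v t x| ≤ C * (1 + x ^ 2)⁻¹ := by
  have hs : ∀ n, ∃ C, ∀ t ∈ Set.Icc 0 T, SchwartzMap.seminorm ℝ n 0 (v t) ≤ C := fun n => by
    have hcs : Continuous (SchwartzMap.seminorm ℝ n 0 : 𝓢(ℝ, ℝ) → ℝ) :=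
      (schwartz_withSeminorms ℝ ℝ ℝ).continuous_seminorm (n, 0)
    obtain ⟨C, hC⟩ := (isCompact_Icc (a := (0 : ℝ)) (b := T)).bddAbove_image
      (hcs.comp hv).continuousOn
    exact ⟨C, fun t ht => hC ⟨t, ht, rfl⟩⟩
  obtain ⟨C₀, h₀⟩ := hs 0
  obtain ⟨C₂, h₂⟩ := hs 2
  refine ⟨C₀ + C₂, fun t ht x => ?_⟩
  rw [← div_eq_mul_inv, le_div_iff₀ (by positivity)]
  have b₀ := (SchwartzMap.norm_pow_mul_le_seminorm ℝ (v t) 0 x).trans (h₀ t ht)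
  have b₂ := (SchwartzMap.norm_pow_mul_le_seminorm ℝ (v t) 2 x).trans (h₂ t ht)
  simp only [Real.norm_eq_abs, sq_abs, pow_zero, one_mul] at b₀ b₂
  linarith

open SchwartzMap in
theorem H1CH_sub_H1CH (a b : 𝓢(ℝ, ℝ)) :
    H1CH a - H1CH b = 1 / 2 * ∫ x, (a x - b x) * ((a x + b x)
      - (derivCLM ℝ ℝ (derivCLM ℝ ℝ a) x + derivCLM ℝ ℝ (derivCLM ℝ ℝ b) x)) := by
  have hmul : ∀ φ ψ : 𝓢(ℝ, ℝ), Integrable fun x => φ x * ψ x := fun φ ψ =>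
    (SchwartzMap.pairing (ContinuousLinearMap.mul ℝ ℝ) φ ψ).integrable
  have hH : ∀ φ : 𝓢(ℝ, ℝ), Integrable fun x => φ x ^ 2 + deriv φ x ^ 2 := fun φ => by
    simpa [sq, Pi.add_def] using (hmul φ φ).add (hmul (derivCLM ℝ ℝ φ) (derivCLM ℝ ℝ φ))
  have hibp := integral_mul_deriv_eq_neg_deriv_mul (a - b) (derivCLM ℝ ℝ (a + b))
  have i1 := hmul (a - b) (a + b)
  have i2 := hmul (a - b) (derivCLM ℝ ℝ (derivCLM ℝ ℝ (a + b)))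
  have i3 := hmul (derivCLM ℝ ℝ (a - b)) (derivCLM ℝ ℝ (a + b))
  rw [H1CH, H1CH, ← mul_sub, ← integral_sub (hH a) (hH b)]
  congr 1
  calc ∫ x, (a x ^ 2 + deriv a x ^ 2 - (b x ^ 2 + deriv b x ^ 2))
      = ∫ x, ((a - b) x * (a + b) x + derivCLM ℝ ℝ (a - b) x * derivCLM ℝ ℝ (a + b) x) :=
        integral_congr_ae (.of_forall fun x => by
          simp only [map_sub, map_add, _root_.sub_apply, _root_.add_apply,
            derivCLM_apply]
          ring)
    _ = ∫ x, ((a - b) x * (a + b) x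
          - (a - b) x * derivCLM ℝ ℝ (derivCLM ℝ ℝ (a + b)) x) := by
        simp only [← derivCLM_apply ℝ] at hibp
        rw [integral_add i1 i3, integral_sub i1 i2, hibp, sub_neg_eq_add]
    _ = _ := integral_congr_ae (.of_forall fun x => by
          simp only [map_add, _root_.sub_apply, _root_.add_apply]
          ring)

open Filter Topology SchwartzMap in
/-- The Camassa–Holm vector field is orthogonal to `(1 − ∂ₓ²) φ`: the product is the derivative of
`−Pφ + P'φ' + φφ'²/2 + kφ²`. -/
theorem integral_camassaHolm_mul_eq_zero (k : ℝ) (φ : 𝓢(ℝ, ℝ)) {P : ℝ → ℝ} {M : ℝ}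
    (hP : ∀ x, HasDerivAt P (deriv P x) x)
    (hP' : ∀ x, HasDerivAt (deriv P)
      (P x - (φ x ^ 2 + 1 / 2 * deriv φ x ^ 2 + 2 * k * φ x)) x)
    (hPM : ∀ x, |P x| ≤ M) (hPM' : ∀ x, |deriv P x| ≤ M) :
    ∫ x, -(φ x * deriv φ x + deriv P x) * (φ x - derivCLM ℝ ℝ (derivCLM ℝ ℝ φ) x) = 0 := by
  set v := derivCLM ℝ ℝ φ with hv
  set w := derivCLM ℝ ℝ v with hw
  have dφ : ∀ x, HasDerivAt φ (v x) x := φ.hasDerivAt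
  have dv : ∀ x, HasDerivAt v (w x) x := v.hasDerivAt
  simp only [← derivCLM_apply ℝ φ, ← hv] at hP' ⊢
  have hcP : Continuous P := continuous_iff_continuousAt.2 fun x => (hP x).continuousAt
  have hcP' : Continuous (deriv P) := continuous_iff_continuousAt.2 fun x => (hP' x).continuousAt
  have hlim : ∀ l : Filter ℝ, l ≤ cocompact ℝ → Tendsto (fun x => -(P x * φ x) + deriv P x * v x
      + 1 / 2 * (φ x * v x ^ 2) + k * φ x ^ 2) l (𝓝 0) := fun l hl => by
    have tφ : Tendsto φ l (𝓝 0) := (zero_at_infty φ).mono_left hl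
    have tv : Tendsto v l (𝓝 0) := (zero_at_infty v).mono_left hl
    have bdd : ∀ {Q : ℝ → ℝ}, (∀ x, |Q x| ≤ M) → l.IsBoundedUnder (· ≤ ·) (norm ∘ Q) :=
      fun h => isBoundedUnder_of ⟨M, h⟩
    simpa [-one_div] using ((isBoundedUnder_le_mul_tendsto_zero (bdd hPM) tφ).neg.add 
      (isBoundedUnder_le_mul_tendsto_zero (bdd hPM') tv)).add
      ((tφ.mul (tv.pow 2)).const_mul (1 / 2)) |>.add ((tφ.pow 2).const_mul k)
  have hd : ∀ x, HasDerivAt (fun x => -(P x * φ x) + deriv P x * v x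
      + 1 / 2 * (φ x * v x ^ 2) + k * φ x ^ 2)
      (-(φ x * v x + deriv P x) * (φ x - w x)) x := fun x => by
    refine (((((hP x).mul (dφ x)).neg.add ((hP' x).mul (dv x))).add
      (((dφ x).mul ((dv x).pow 2)).const_mul (1 / 2))).add
      (((dφ x).pow 2).const_mul k)).congr_deriv ?_
    norm_num
    ring
  have hi : Integrable fun x => -(φ x * v x + deriv P x) * (φ x - w x) := by
    have i1 : Integrable fun x => φ x * (v x * (φ x - w x)) :=
      (pairing (ContinuousLinearMap.mul ℝ ℝ) φ
        (pairing (ContinuousLinearMap.mul ℝ ℝ) v (φ - w))).integrable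
    have i2 : Integrable fun x => deriv P x * (φ x - w x) :=
      (φ - w).integrable.bdd_mul hcP'.aestronglyMeasurable (.of_forall hPM')
    refine (i1.add i2).neg.congr (.of_forall fun x => ?_)
    simp only [Pi.neg_apply, Pi.add_apply]
    ring
  rw [integral_of_hasDerivAt_of_tendsto hd hi (hlim _ atBot_le_cocompact)
    (hlim _ atTop_le_cocompact), sub_zero]

theorem SchwartzMap.exists_uniform_decay_derivs {u : ℝ → 𝓢(ℝ, ℝ)} (hu : Continuous u) (T : ℝ) :
    ∃ C, ∀ t ∈ Set.Icc 0 T, ∀ x, |u t x| ≤ C * (1 + x ^ 2)⁻¹ ∧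
      |derivCLM ℝ ℝ (u t) x| ≤ C * (1 + x ^ 2)⁻¹ ∧
      |derivCLM ℝ ℝ (derivCLM ℝ ℝ (u t)) x| ≤ C * (1 + x ^ 2)⁻¹ := by
  have hv := (derivCLM ℝ ℝ).continuous.comp hu
  obtain ⟨C₀, h₀⟩ := exists_uniform_decay hu T
  obtain ⟨C₁, h₁⟩ := exists_uniform_decay hv T
  obtain ⟨C₂, h₂⟩ := exists_uniform_decay ((derivCLM ℝ ℝ).continuous.comp hv) T
  have hle : ∀ {c : ℝ} (x : ℝ), c ≤ max C₀ (max C₁ C₂) →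
      c * (1 + x ^ 2)⁻¹ ≤ max C₀ (max C₁ C₂) * (1 + x ^ 2)⁻¹ :=
    fun x hc => mul_le_mul_of_nonneg_right hc (by positivity)
  exact ⟨max C₀ (max C₁ C₂), fun t ht x => ⟨(h₀ t ht x).trans (hle x (by simp)),
    (h₁ t ht x).trans (hle x (by simp)), (h₂ t ht x).trans (hle x (by simp))⟩⟩

theorem SchwartzMap.continuous_eval (x : ℝ) : Continuous fun φ : 𝓢(ℝ, ℝ) => φ x :=
  (BoundedContinuousFunction.lipschitz_eval_const x).continuous.comp
    (toBoundedContinuousFunctionCLM ℝ ℝ ℝ).continuous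

/-- Let `k ≥ 0`, `T > 0`, and let `u : [0,T] × ℝ → ℝ` be smooth, with
`t ↦ u(t,·)` a C¹ map into Schwartz space (encoded by continuity of the Schwartz-valued curve,
joint smoothness, and pointwise time differentiability), solving the Camassa–Holm equation in
nonlocal form `∂_t u + u ∂_x u + ∂_x P = 0`, where
`P(t,·) = K * (u(t,·)² + (1/2)(∂_x u(t,·))² + 2k u(t,·))` and `K(x) = (1/2) e^{−|x|}`.
Then `H₁(u(t,·))` is constant in `t` on `[0,T]`. -/
theorem stmt7 (k : ℝ) (hk : 0 ≤ k) (T : ℝ) (hT : 0 < T)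
    (u : ℝ → 𝓢(ℝ, ℝ))
    (hsmooth : ContDiffOn ℝ (⊤ : ℕ∞) (fun p : ℝ × ℝ => u p.1 p.2) (Set.Icc 0 T ×ˢ Set.univ))
    (hcont : Continuous u)
    (hPDE : ∀ t ∈ Set.Icc (0 : ℝ) T, ∀ x : ℝ,
      HasDerivWithinAt (fun s => u s x)
        (-(u t x * deriv (⇑(u t)) x
            + deriv (KConv (fun y => (u t y) ^ 2 + (1 / 2) * (deriv (⇑(u t)) y) ^ 2
                + 2 * k * u t y)) x))
        (Set.Icc 0 T) t) :
    ∀ t ∈ Set.Icc (0 : ℝ) T, H1CH (⇑(u t)) = H1CH (⇑(u 0)) := by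
  obtain ⟨C, hC⟩ := SchwartzMap.exists_uniform_decay_derivs hcont T
  set v : ℝ → 𝓢(ℝ, ℝ) := fun t => derivCLM ℝ ℝ (u t)
  set w : ℝ → 𝓢(ℝ, ℝ) := fun t => derivCLM ℝ ℝ (v t)
  have hvc : Continuous v := (derivCLM ℝ ℝ).continuous.comp hcont
  have hwc : Continuous w := (derivCLM ℝ ℝ).continuous.comp hvc
  set f : ℝ → ℝ → ℝ := fun t y =>
    (u t y) ^ 2 + (1 / 2) * (deriv (⇑(u t)) y) ^ 2 + 2 * k * u t y with hf
  set P : ℝ → ℝ → ℝ := fun t => KConv (f t)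
  have hC0 : 0 ≤ C := by
    have := (abs_nonneg _).trans (hC 0 ⟨le_rfl, hT.le⟩ 0).1
    simpa using this
  have hω1 : ∀ x : ℝ, (1 + x ^ 2)⁻¹ ≤ 1 := fun x => inv_le_one_of_one_le₀ (by nlinarith)
  have hle : ∀ x : ℝ, C * (1 + x ^ 2)⁻¹ ≤ C := fun x => mul_le_of_le_one_right hC0 (hω1 x)
  have hfc : ∀ t, Continuous (f t) := fun t => by
    have h1 := (u t).continuous
    have h2 : Continuous (deriv (u t)) := (v t).continuous
    simp only [hf]
    fun_prop
  have hfb : ∀ t ∈ Set.Icc (0 : ℝ) T, ∀ x,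
      |f t x| ≤ (3 / 2 * C ^ 2 + 2 * k * C) * (1 + x ^ 2)⁻¹ := fun t ht x => by
    obtain ⟨b1, b2, -⟩ := hC t ht x
    have hsq : ∀ {z : ℝ}, |z| ≤ C * (1 + x ^ 2)⁻¹ →
        z ^ 2 ≤ C ^ 2 * (1 + x ^ 2)⁻¹ := fun {z} hz => by
      rw [← sq_abs]
      calc |z| ^ 2 = |z| * |z| := sq _
        _ ≤ C * (C * (1 + x ^ 2)⁻¹) := mul_le_mul (hz.trans (hle x)) hz (abs_nonneg _) hC0
        _ = _ := by ring
    have s1 := hsq b1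
    have s2 := hsq b2
    have s3 := abs_le.1 b1
    have s4 := mul_le_mul_of_nonneg_left s3.2 hk
    have s5 := mul_le_mul_of_nonneg_left s3.1 hk
    have s6 := sq_nonneg (u t x)
    have s7 := sq_nonneg (v t x)
    change |u t x ^ 2 + 1 / 2 * v t x ^ 2 + 2 * k * u t x| ≤ _
    rw [abs_le]
    constructor <;> nlinarith
  have hDi : Integrable fun x : ℝ => (3 / 2 * C ^ 2 + 2 * k * C) * (1 + x ^ 2)⁻¹ :=
    integrable_inv_one_add_sq.const_mul _
  set M := ∫ x : ℝ, (3 / 2 * C ^ 2 + 2 * k * C) * (1 + x ^ 2)⁻¹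
  have hfi : ∀ t ∈ Set.Icc (0 : ℝ) T, Integrable (f t) := fun t ht =>
    hDi.mono' (hfc t).aestronglyMeasurable (.of_forall (hfb t ht))
  have hfM : ∀ t ∈ Set.Icc (0 : ℝ) T, ∫ y, |f t y| ≤ M := fun t ht =>
    integral_mono (hfi t ht).abs hDi (hfb t ht)
  have hK : ∀ t ∈ Set.Icc (0 : ℝ) T, ∀ x, _ := fun t ht =>
    KConv_hasDerivAt_and_bounds (hfc t) (hfi t ht)
  set G := C ^ 2 + M
  have hg : ∀ t ∈ Set.Icc (0 : ℝ) T, ∀ x,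
      ‖-(u t x * deriv (u t) x + deriv (P t) x)‖ ≤ G := fun t ht x => by
    obtain ⟨b1, b2, -⟩ := hC t ht x
    rw [norm_neg]
    refine (norm_add_le _ _).trans (add_le_add ?_ ((hK t ht x).2.2.2.trans (hfM t ht)))
    rw [norm_mul, sq]
    exact mul_le_mul (b1.trans (hle x)) (b2.trans (hle x)) (abs_nonneg _) hC0
  have hderiv : ∀ s ∈ Set.Icc (0 : ℝ) T,
      HasDerivWithinAt (fun t => H1CH (u t)) 0 (Set.Icc 0 T) s := fun s hs => by
    rw [hasDerivWithinAt_iff_tendsto_slope]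
    have hslope : ∀ t, slope (fun t => H1CH (u t)) s t
        = 1 / 2 * ∫ x, slope (fun r => u r x) s t * ((u t x + u s x) - (w t x + w s x)) :=
        fun t => by
      simp only [slope_def_module, smul_eq_mul, mul_assoc]
      rw [H1CH_sub_H1CH, integral_const_mul]
      ring
    have hzero : ∫ x, -(u s x * deriv (u s) x + deriv (P s) x) *
        ((u s x + u s x) - (w s x + w s x)) = 0 := by
      have h0 := integral_camassaHolm_mul_eq_zero k (u s) (P := P s) (M := M)
        (fun x => (hK s hs x).1) (fun x => (hK s hs x).2.1)
        (fun x => (hK s hs x).2.2.1.trans (hfM s hs))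
        (fun x => (hK s hs x).2.2.2.trans (hfM s hs))
      rw [← mul_zero 2, ← h0, ← integral_const_mul]
      exact integral_congr_ae (.of_forall fun x => by ring)
    suffices h : Filter.Tendsto (fun t => ∫ x, slope (fun r => u r x) s t *
        ((u t x + u s x) - (w t x + w s x))) (nhdsWithin s (Set.Icc 0 T \ {s}))
        (nhds (∫ x, -(u s x * deriv (u s) x + deriv (P s) x) *
          ((u s x + u s x) - (w s x + w s x)))) by
      rw [hzero] at h
      have h' := h.const_mul (1 / 2)
      rw [mul_zero] at h'
      exact h'.congr fun t => (hslope t).symm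
    refine tendsto_integral_filter_of_dominated_convergence
      (fun x => G * (4 * (C * (1 + x ^ 2)⁻¹))) (.of_forall fun t => ?_) ?_
      (((integrable_inv_one_add_sq.const_mul C).const_mul 4).const_mul G)
      (.of_forall fun x => ?_)
    · refine Continuous.aestronglyMeasurable ?_
      simp only [slope_def_module]
      fun_prop
    · filter_upwards [self_mem_nhdsWithin] with t ht
      refine .of_forall fun x => ?_
      have hts : 0 < ‖t - s‖ := norm_pos_iff.2 (sub_ne_zero.2 ht.2)
      have b1 : ‖slope (fun r => u r x) s t‖ ≤ G := by
        rw [slope_def_module, norm_smul, norm_inv, inv_mul_le_iff₀ hts, mul_comm]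
        exact (convex_Icc 0 T).norm_image_sub_le_of_norm_hasDerivWithin_le
          (fun r hr => hPDE r hr x) (fun r hr => hg r hr x) hs ht.1
      have b2 : ‖(u t x + u s x) - (w t x + w s x)‖ ≤ 4 * (C * (1 + x ^ 2)⁻¹) := by
        have c1 := abs_le.1 (hC t ht.1 x).1
        have c2 := abs_le.1 (hC s hs x).1
        have c3 := abs_le.1 (hC t ht.1 x).2.2
        have c4 := abs_le.1 (hC s hs x).2.2
        rw [Real.norm_eq_abs, abs_le]
        constructor <;> linarith
      rw [norm_mul]
      exact mul_le_mul b1 b2 (norm_nonneg _) ((norm_nonneg _).trans b1)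
    · have hev : ∀ {z : ℝ → 𝓢(ℝ, ℝ)}, Continuous z →
          Filter.Tendsto (fun t => z t x) (nhdsWithin s (Set.Icc 0 T \ {s})) (nhds (z s x)) :=
        fun {z} hz => ((SchwartzMap.continuous_eval x).comp hz).continuousAt.tendsto.mono_left nhdsWithin_le_nhds
      exact (hasDerivWithinAt_iff_tendsto_slope.1 (hPDE s hs x)).mul
        (((hev hcont).add tendsto_const_nhds).sub ((hev hwc).add tendsto_const_nhds))
  exact constant_of_derivWithin_zero (fun s hs => (hderiv s hs).differentiableWithinAt)
    fun s hs => (hderiv s ⟨hs.1, hs.2.le⟩).derivWithin (uniqueDiffOn_Icc hT s ⟨hs.1, hs.2.le⟩)
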